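/- Let N ≥ 3, K(y) = exp(|y|²/4), 2* = 2N/(N−2), p = 2*−1, β = (N−2)/4, and μ ∈ [0, (N−2)²/8]. Let S_0 = inf{ ∫_{ℝ^N}|∇v|² dx : v ∈ C_c^∞(ℝ^N), ∫_{ℝ^N}|v|^{2*} dx = 1 } be the classical Sobolev constant. Then for every v in X with v ≠ 0 one has A(v) ≥ (S_0/2) · ‖v‖²_{K,p+1}; equivalently, the constant S_K := inf{ A(v)/‖v‖²_{K,p+1} : v ∈ X, v ≠ 0 } satisfies S_K ≥ S_0/2 > 0. -/

import Mathlib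

open MeasureTheory Real Set

noncomputable section

abbrev Euc (N : ℕ) := EuclideanSpace ℝ (Fin N)

def Kw {N : ℕ} (x : Euc N) : ℝ := Real.exp (‖x‖ ^ 2 / 4)

def twoStar (N : ℕ) : ℝ := 2 * N / ((N : ℝ) - 2)

structure MemX {N : ℕ} (v : Euc N → ℝ) : Prop where
  diff : Differentiable ℝ v
  int_grad : Integrable fun x => ‖gradient v x‖ ^ 2 * Kw x
  int_sq : Integrable fun x => v x ^ 2 * Kw x
  int_hardy : Integrable fun x => v x ^ 2 / ‖x‖ ^ 2 * Kw x
  int_crit : Integrable fun x => |v x| ^ twoStar N * Kw x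

def Afun {N : ℕ} (μ : ℝ) (v : Euc N → ℝ) : ℝ :=
  ∫ x, (‖gradient v x‖ ^ 2 - μ * v x ^ 2 / ‖x‖ ^ 2 - ((N : ℝ) - 2) / 4 * v x ^ 2) * Kw x

def Bfun {N : ℕ} (v : Euc N → ℝ) : ℝ := ∫ x, |v x| ^ twoStar N * Kw x

def EKf {N : ℕ} (μ : ℝ) (v : Euc N → ℝ) : ℝ := Afun μ v / 2 - Bfun v / twoStar N

def DK {N : ℕ} (μ : ℝ) (v : Euc N → ℝ) : ℝ := Afun μ v - Bfun v

def DKd {N : ℕ} (μ δ : ℝ) (v : Euc N → ℝ) : ℝ := δ * Afun μ v - Bfun v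

def normKp1Sq {N : ℕ} (v : Euc N → ℝ) : ℝ := Bfun v ^ (2 / twoStar N)

def SK (N : ℕ) (μ : ℝ) : ℝ :=
  sInf { r | ∃ v : Euc N → ℝ, MemX v ∧ v ≠ 0 ∧ r = Afun μ v / normKp1Sq v }

def rdel (N : ℕ) (μ δ : ℝ) : ℝ := δ ^ (((N : ℝ) - 2) / 2) * SK N μ ^ ((N : ℝ) / 2)

def gradNormSq {N : ℕ} (v : Euc N → ℝ) : ℝ := ∫ x, ‖gradient v x‖ ^ 2 * Kw x

def normKsq {N : ℕ} (v : Euc N → ℝ) : ℝ := ∫ x, v x ^ 2 * Kw x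

def ddepth (N : ℕ) (μ δ : ℝ) : ℝ :=
  sInf { e | ∃ v : Euc N → ℝ, MemX v ∧ DKd μ δ v = 0 ∧ gradNormSq v ≠ 0 ∧ e = EKf μ v }

def dwell (N : ℕ) (μ : ℝ) : ℝ :=
  sInf { e | ∃ v : Euc N → ℝ, MemX v ∧ v ≠ 0 ∧ DK μ v = 0 ∧ e = EKf μ v }

/-- The classical Sobolev constant S₀. -/
def S0 (N : ℕ) : ℝ :=
  sInf { r | ∃ v : Euc N → ℝ, ContDiff ℝ (⊤ : ℕ∞) v ∧ HasCompactSupport v ∧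
    (∫ x : Euc N, |v x| ^ twoStar N) = 1 ∧ r = ∫ x : Euc N, ‖gradient v x‖ ^ 2 }

section Sobolev

open Filter Topology Module
open scoped Convolution

variable {N : ℕ}

lemma norm_gradient_eq (f : Euc N → ℝ) (x : Euc N) : ‖gradient f x‖ = ‖fderiv ℝ f x‖ := by
  rw [gradient, LinearIsometryEquiv.norm_map]

lemma twoStar_gt (hN : 3 ≤ N) : 2 < twoStar N := by
  have h : (3 : ℝ) ≤ N := by exact_mod_cast hN
  rw [twoStar, lt_div_iff₀ (by linarith)]
  linarith

lemma continuous_gradient {u : Euc N → ℝ} (hu : ContDiff ℝ 1 u) : Continuous (gradient u) :=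
  (LinearIsometryEquiv.continuous _).comp (hu.continuous_fderiv one_ne_zero)

lemma hasCompactSupport_gradient {u : Euc N → ℝ} (hc : HasCompactSupport u) :
    HasCompactSupport (gradient u) :=
  (hc.fderiv (𝕜 := ℝ)).comp_left (map_zero (InnerProductSpace.toDual ℝ (Euc N)).symm)

lemma integrable_abs_rpow {u : Euc N → ℝ} (hu : Continuous u) (hc : HasCompactSupport u)
    {q : ℝ} (hq : 0 < q) : Integrable fun x => |u x| ^ q := by
  refine Continuous.integrable_of_hasCompactSupport
    (hu.abs.rpow_const fun _ => Or.inr hq.le) ?_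
  exact hc.comp_left (g := fun t : ℝ => |t| ^ q) (by simp [hq.ne'])

lemma integral_abs_rpow_pos {u : Euc N → ℝ} (hu : Continuous u) (h0 : u ≠ 0)
    {q : ℝ} (hq : 0 < q) {k : Euc N → ℝ} (hk : Continuous k) (hkpos : ∀ x, 0 < k x)
    (hi : Integrable fun x => |u x| ^ q * k x) :
    0 < ∫ x, |u x| ^ q * k x := by
  obtain ⟨x₀, hx₀⟩ := Function.ne_iff.1 h0
  refine integral_pos_of_integrable_nonneg_nonzero (x := x₀) ?_ hi ?_ ?_
  · exact (hu.abs.rpow_const fun _ => Or.inr hq.le).mul hk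
  · exact fun x => mul_nonneg (Real.rpow_nonneg (abs_nonneg _) _) (hkpos x).le
  · exact (mul_pos (Real.rpow_pos_of_pos (abs_pos.2 hx₀) _) (hkpos x₀)).ne'

/-- The gradient energies of the competitors in the Sobolev constant. -/
def sobolevSet (N : ℕ) : Set ℝ :=
  { r | ∃ v : Euc N → ℝ, ContDiff ℝ (⊤ : ℕ∞) v ∧ HasCompactSupport v ∧
    (∫ x : Euc N, |v x| ^ twoStar N) = 1 ∧ r = ∫ x : Euc N, ‖gradient v x‖ ^ 2 }

lemma S0_eq : S0 N = sInf (sobolevSet N) := rfl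

lemma sobolevSet_bddBelow : BddBelow (sobolevSet N) := by
  refine ⟨0, ?_⟩
  rintro r ⟨v, -, -, -, rfl⟩
  exact integral_nonneg fun x => by positivity

lemma normalized_mem_sobolevSet (hN : 3 ≤ N) {u : Euc N → ℝ} (hu : ContDiff ℝ (⊤ : ℕ∞) u)
    (hc : HasCompactSupport u) (hpos : 0 < ∫ x, |u x| ^ twoStar N) :
    ((∫ x, |u x| ^ twoStar N) ^ (2 / twoStar N))⁻¹ * ∫ x, ‖gradient u x‖ ^ 2 ∈ sobolevSet N := by
  set c := ∫ x, |u x| ^ twoStar N with hcdef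
  have hq := (twoStar_gt hN)
  have hq0 : twoStar N ≠ 0 := by linarith
  set t := c ^ (-(1 / twoStar N)) with ht
  have htpos : 0 < t := Real.rpow_pos_of_pos hpos _
  refine ⟨fun x => t * u x, contDiff_const.mul hu, hc.mul_left, ?_, ?_⟩
  · have h1 : ∀ x, |t * u x| ^ twoStar N = c⁻¹ * |u x| ^ twoStar N := by
      intro x
      rw [abs_mul, Real.mul_rpow (abs_nonneg _) (abs_nonneg _), abs_of_pos htpos, ht,
        ← Real.rpow_mul hpos.le, ← Real.rpow_neg_one]
      congr 2
      field_simp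
    simp_rw [h1]
    rw [integral_const_mul, inv_mul_cancel₀ hpos.ne']
  · have h2 : ∀ x, ‖gradient (fun x => t * u x) x‖ ^ 2
        = (c ^ (2 / twoStar N))⁻¹ * ‖gradient u x‖ ^ 2 := by
      intro x
      rw [norm_gradient_eq, norm_gradient_eq,
        fderiv_const_mul ((hu.differentiable (by simp)) x), norm_smul, mul_pow, Real.norm_eq_abs,
        sq_abs, ht, ← Real.rpow_natCast, ← Real.rpow_mul hpos.le, ← Real.rpow_neg hpos.le]
      congr 2
      push_cast
      ring
    simp_rw [h2]
    rw [integral_const_mul]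

lemma S0_mul_le_of_contDiff (hN : 3 ≤ N) {u : Euc N → ℝ} (hu : ContDiff ℝ (⊤ : ℕ∞) u)
    (hc : HasCompactSupport u) :
    S0 N * (∫ x, |u x| ^ twoStar N) ^ (2 / twoStar N) ≤ ∫ x, ‖gradient u x‖ ^ 2 := by
  have hq := twoStar_gt hN
  have h0 : 0 ≤ ∫ x, |u x| ^ twoStar N :=
    integral_nonneg fun x => Real.rpow_nonneg (abs_nonneg _) _
  rcases h0.eq_or_lt with h | h
  · rw [← h, Real.zero_rpow (by positivity), mul_zero]
    exact integral_nonneg fun x => by positivity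
  · have := csInf_le sobolevSet_bddBelow (normalized_mem_sobolevSet hN hu hc h)
    rwa [← S0_eq, inv_mul_eq_div, le_div_iff₀ (Real.rpow_pos_of_pos h _)] at this

lemma S0_pos (hN : 3 ≤ N) : 0 < S0 N := by
  have hq := twoStar_gt hN
  have hNr : (3 : ℝ) ≤ N := by exact_mod_cast hN
  have hne : (sobolevSet N).Nonempty := by
    let φ : ContDiffBump (0 : Euc N) := ⟨1, 2, one_pos, one_lt_two⟩
    have hφ : (φ : Euc N → ℝ) ≠ 0 := fun h => by
      have h1 : φ 0 = 1 := φ.one_of_mem_closedBall (Metric.mem_closedBall_self zero_le_one)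
      simp [h] at h1
    refine ⟨_, normalized_mem_sobolevSet hN φ.contDiff φ.hasCompactSupport ?_⟩
    have h := integral_abs_rpow_pos φ.continuous (q := twoStar N) (k := fun _ => 1)
      hφ (by linarith) continuous_const
      (fun _ => one_pos)
      (by simpa using integrable_abs_rpow φ.continuous φ.hasCompactSupport (by linarith))
    simpa using h
  let C : ℝ := SNormLESNormFDerivOfEqConst ℝ (volume : Measure (Euc N)) 2
  have hC : 0 ≤ C := NNReal.coe_nonneg _
  have key : 1 / (C + 1) ^ 2 ≤ S0 N := by
    refine le_csInf hne ?_
    rintro r ⟨v, hv, hc, h1, rfl⟩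
    set E := ∫ x, ‖gradient v x‖ ^ 2 with hE
    have hE0 : 0 ≤ E := integral_nonneg fun x => by positivity
    let q : NNReal := ⟨twoStar N, by linarith⟩
    have gns := eLpNorm_le_eLpNorm_fderiv_of_eq (F := ℝ) (volume : Measure (Euc N))
      (u := v) (hv.of_le (by simp)) hc (p := 2) (p' := q) (by norm_num)
      (by simp; omega) (by
        change (twoStar N)⁻¹ = _
        rw [twoStar]
        simp only [finrank_euclideanSpace, Fintype.card_fin, NNReal.coe_inv, NNReal.coe_ofNat]
        have : (N : ℝ) - 2 ≠ 0 := by linarith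
        field_simp)
    have m1 : MemLp v q := hv.continuous.memLp_of_hasCompactSupport hc
    have m2 : MemLp (fderiv ℝ v) 2 :=
      (hv.continuous_fderiv (by simp)).memLp_of_hasCompactSupport (hc.fderiv (𝕜 := ℝ))
    have hq0 : (q : ENNReal) ≠ 0 := by
      have : q ≠ 0 := by
        intro h
        have := congrArg NNReal.toReal h
        change twoStar N = 0 at this
        linarith
      exact_mod_cast this
    rw [m1.eLpNorm_eq_integral_rpow_norm hq0 (by simp)] at gns
    have e2 := m2.eLpNorm_eq_integral_rpow_norm (by simp) (by simp)
    have hqr : (q : ENNReal).toReal = twoStar N := rfl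
    rw [hqr] at gns
    simp only [Real.norm_eq_abs] at gns
    rw [h1, Real.one_rpow] at gns
    have e3 : ∫ x, ‖fderiv ℝ v x‖ ^ (ENNReal.toReal 2) = E := by
      rw [hE]
      congr 1
      ext x
      rw [norm_gradient_eq]
      simp
    rw [e3] at e2
    norm_cast at e2 gns
    rw [e2, ← ENNReal.ofReal_coe_nnreal, ← ENNReal.ofReal_mul (by positivity),
      ENNReal.one_le_ofReal] at gns
    change 1 ≤ C * _ at gns
    have e4 : E ^ (ENNReal.toReal 2)⁻¹ = √E := by
      rw [Real.sqrt_eq_rpow]; norm_num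
    have gns' : 1 ≤ (C + 1) * √E := by
      have h5 : C * √E ≤ (C + 1) * √E := by
        have := Real.sqrt_nonneg E
        nlinarith
      rw [← e4] at h5 ⊢
      exact gns.trans h5
    rw [div_le_iff₀ (by positivity)]
    have := Real.sq_sqrt hE0
    calc (1 : ℝ) ≤ ((C + 1) * √E) ^ 2 := one_le_pow₀ gns'
      _ = E * (C + 1) ^ 2 := by rw [mul_pow, this]; ring
  exact lt_of_lt_of_le (by positivity) key
lemma integrable_mul_of_hasCompactSupport {F g : Euc N → ℝ} (hF : Integrable F)
    (hc : HasCompactSupport F) (hg : Continuous g) : Integrable fun x => F x * g x := by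
  have h := (hF.integrableOn (s := tsupport F)).mul_continuousOn hg.continuousOn hc
  refine (integrableOn_iff_integrable_of_support_subset ?_).1 h
  exact (Function.support_mul_subset_left _ _).trans (subset_tsupport F)

lemma measurable_gradient (f : Euc N → ℝ) : Measurable (gradient f) :=
  (LinearIsometryEquiv.continuous _).measurable.comp (measurable_fderiv ℝ f)

lemma integrable_inner_gradient {f : Euc N → ℝ} (hc : HasCompactSupport f)
    (hi : Integrable fun x => ‖gradient f x‖ ^ 2) {h : Euc N → Euc N} (hh : Continuous h) :
    Integrable fun x => inner ℝ (gradient f x) (h x) := by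
  have h1 : Integrable (fun x => ‖gradient f x‖) := by
    have hg : Integrable ((tsupport f).indicator fun _ => (1 : ℝ)) :=
      (integrable_indicator_iff (isClosed_tsupport f).measurableSet).2
        (integrableOn_const hc.measure_lt_top.ne)
    refine (hi.add hg).mono' (measurable_gradient f).norm.aestronglyMeasurable
      (Filter.Eventually.of_forall fun x => ?_)
    by_cases hx : x ∈ tsupport f
    · simp only [Pi.add_apply, Set.indicator_of_mem hx, norm_norm]
      nlinarith [sq_nonneg (‖gradient f x‖ - 1)]
    · have : gradient f x = 0 := by
        rw [← norm_eq_zero, norm_gradient_eq,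
          image_eq_zero_of_notMem_tsupport (fun h => hx (tsupport_fderiv_subset ℝ h)), norm_zero]
      simp [this, hx]
  refine (integrable_mul_of_hasCompactSupport h1
    (hasCompactSupport_gradient hc).norm hh.norm).mono'
    ((measurable_gradient f).inner hh.measurable).aestronglyMeasurable
    (Filter.Eventually.of_forall fun x => norm_inner_le_norm _ _)

lemma integral_mul_fderiv_eq_neg {f g : Euc N → ℝ} (hf : Differentiable ℝ f)
    (hc : HasCompactSupport f) (hi : Integrable fun x => ‖gradient f x‖ ^ 2)
    (hg : ContDiff ℝ 1 g) (e : Euc N) :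
    ∫ x, f x * fderiv ℝ g x e = -∫ x, inner ℝ (gradient f x) (g x • e) := by
  have h1 : ∀ x, inner ℝ (gradient f x) (g x • e) = fderiv ℝ f x e * g x := by
    intro x
    rw [inner_smul_right, inner_gradient_left, mul_comm]
  have h2 := integrable_inner_gradient hc hi (h := fun x => g x • e)
    (hg.continuous.smul continuous_const)
  simp_rw [h1] at h2 ⊢
  have hfi : Integrable f := hf.continuous.integrable_of_hasCompactSupport hc
  refine integral_mul_fderiv_eq_neg_fderiv_mul_of_integrable h2 ?_ ?_
    (fun x _ => hf x) fun x _ => (hg.differentiable one_ne_zero) x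
  · exact integrable_mul_of_hasCompactSupport hfi hc
      ((hg.continuous_fderiv one_ne_zero).clm_apply continuous_const)
  · exact integrable_mul_of_hasCompactSupport hfi hc hg.continuous

lemma integral_sq_norm_gradient_convolution_le {f : Euc N → ℝ} (hf : Differentiable ℝ f)
    (hc : HasCompactSupport f) (hi : Integrable fun x => ‖gradient f x‖ ^ 2)
    (φ : ContDiffBump (0 : Euc N)) :
    ∫ x, ‖gradient (f ⋆[ContinuousLinearMap.mul ℝ ℝ] φ.normed volume) x‖ ^ 2
      ≤ ∫ x, ‖gradient f x‖ ^ 2 := by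
  set ψ := φ.normed (volume : Measure (Euc N)) with hψ
  have hψs : ContDiff ℝ 1 ψ := φ.contDiff_normed (n := 1)
  have hψc : HasCompactSupport ψ := φ.hasCompactSupport_normed
  have hψi : Integrable ψ := φ.integrable_normed
  set u := f ⋆[ContinuousLinearMap.mul ℝ ℝ] ψ with hu
  have key : ∀ x, ‖gradient u x‖ ^ 2
      ≤ ((fun t => ‖gradient f t‖ ^ 2) ⋆[ContinuousLinearMap.mul ℝ ℝ] ψ) x := by
    intro x
    set G := gradient u x with hG
    have hd := hψc.hasFDerivAt_convolution_right (ContinuousLinearMap.mul ℝ ℝ)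
      (hf.continuous.locallyIntegrable (μ := volume)) hψs x
    have hψx : ContDiff ℝ 1 fun t => ψ (x - t) := hψs.comp (contDiff_const.sub contDiff_id)
    have hψxi : Integrable fun t => ψ (x - t) := hψi.comp_sub_left x
    have e1 : ‖G‖ ^ 2 = fderiv ℝ u x G := by
      rw [← inner_gradient_left, ← hG, real_inner_self_eq_norm_sq]
    have e2 : fderiv ℝ u x G = ∫ t, inner ℝ (gradient f t) (ψ (x - t) • G) := by
      rw [hd.fderiv, convolution_precompR_apply _ (hf.continuous.locallyIntegrable)
        (hψc.fderiv (𝕜 := ℝ)) (hψs.continuous_fderiv one_ne_zero), convolution_def]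
      have h3 : ∀ t, fderiv ℝ (fun t => ψ (x - t)) t G = -(fderiv ℝ ψ (x - t) G) := by
        intro t
        have : HasFDerivAt (fun t => ψ (x - t))
            ((fderiv ℝ ψ (x - t)).comp (-ContinuousLinearMap.id ℝ (Euc N))) t :=
          ((hψs.differentiable one_ne_zero) (x - t)).hasFDerivAt.comp t
            ((hasFDerivAt_id t).const_sub x)
        rw [this.fderiv]
        simp
      have h4 := integral_mul_fderiv_eq_neg hf hc hi hψx G
      simp_rw [h3, mul_neg, integral_neg, neg_inj] at h4
      simpa using h4
    have i1 : Integrable fun t => ‖gradient f t‖ ^ 2 * ψ (x - t) :=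
      integrable_mul_of_hasCompactSupport hi
        ((hasCompactSupport_gradient hc).comp_left (g := fun v => ‖v‖ ^ 2) (by simp))
        hψx.continuous
    have e3 : ∫ t, inner ℝ (gradient f t) (ψ (x - t) • G)
        ≤ ∫ t, (‖G‖ ^ 2 / 2 * ψ (x - t) + 1 / 2 * (‖gradient f t‖ ^ 2 * ψ (x - t))) := by
      refine integral_mono (integrable_inner_gradient hc hi
        (hψx.continuous.smul continuous_const)) ((hψxi.const_mul _).add (i1.const_mul _)) ?_
      intro t
      dsimp only
      rw [inner_smul_right]
      have h5 := real_inner_le_norm (gradient f t) G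
      have h6 : inner ℝ (gradient f t) G ≤ ‖G‖ ^ 2 / 2 + ‖gradient f t‖ ^ 2 / 2 := by
        nlinarith [sq_nonneg (‖gradient f t‖ - ‖G‖)]
      have h7 : 0 ≤ ψ (x - t) := φ.nonneg_normed _
      nlinarith
    rw [integral_add (hψxi.const_mul _) (i1.const_mul _), integral_const_mul, integral_const_mul,
      integral_sub_left_eq_self ψ volume x, φ.integral_normed] at e3
    have e4 : ((fun t => ‖gradient f t‖ ^ 2) ⋆[ContinuousLinearMap.mul ℝ ℝ] ψ) x
      = ∫ t, ‖gradient f t‖ ^ 2 * ψ (x - t) := rfl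
    rw [e4]
    linarith
  calc ∫ x, ‖gradient u x‖ ^ 2
      ≤ ∫ x, ((fun t => ‖gradient f t‖ ^ 2) ⋆[ContinuousLinearMap.mul ℝ ℝ] ψ) x :=
        integral_mono_of_nonneg (Filter.Eventually.of_forall fun x => by positivity)
          (hi.integrable_convolution _ hψi) (Filter.Eventually.of_forall key)
    _ = _ := by
      rw [integral_convolution _ hi hψi, φ.integral_normed]
      simp

lemma mul_convolution_eq (f : Euc N → ℝ) (φ : ContDiffBump (0 : Euc N)) :
    f ⋆[ContinuousLinearMap.mul ℝ ℝ] φ.normed volume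
      = φ.normed volume ⋆[ContinuousLinearMap.lsmul ℝ ℝ] f := by
  ext x
  rw [convolution_eq_swap, convolution_def]
  simp only [ContinuousLinearMap.mul_apply', ContinuousLinearMap.lsmul_apply, smul_eq_mul, mul_comm]

lemma exists_contDiffBump_seq (N : ℕ) : ∃ φ : ℕ → ContDiffBump (0 : Euc N),
    (∀ n, (φ n).rOut ≤ 1) ∧ Tendsto (fun n => (φ n).rOut) atTop (𝓝 0) := by
  refine ⟨fun n => ⟨1 / (n + 2), 1 / (n + 1), by positivity, ?_⟩, fun n => ?_, ?_⟩
  · apply one_div_lt_one_div_of_lt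
    · positivity
    · linarith
  · change 1 / ((n : ℝ) + 1) ≤ 1
    rw [div_le_one (by positivity)]
    linarith [(Nat.cast_nonneg n : (0 : ℝ) ≤ n)]
  · exact tendsto_one_div_add_atTop_nhds_zero_nat

lemma abs_normed_convolution_le {f : Euc N → ℝ} (hf : Continuous f) {C : ℝ} (hC0 : 0 ≤ C)
    (hC : ∀ x, ‖f x‖ ≤ C) (φ : ContDiffBump (0 : Euc N)) (x : Euc N) :
    |(φ.normed volume ⋆[ContinuousLinearMap.lsmul ℝ ℝ] f : Euc N → ℝ) x| ≤ C := by
  have := dist_convolution_le (x₀ := x) (ε := C) (z₀ := (0 : ℝ)) (f := φ.normed volume)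
    (g := f) (μ := volume) hC0 φ.support_normed_eq.subset φ.nonneg_normed
    φ.integral_normed hf.aestronglyMeasurable
    (fun y _ => by simpa using hC y)
  simpa using this

lemma normed_convolution_eq_zero {f : Euc N → ℝ} (hf : Continuous f) {R : ℝ}
    (hR : ∀ x : Euc N, R < ‖x‖ → f x = 0) {φ : ContDiffBump (0 : Euc N)} (hφ : φ.rOut ≤ 1)
    {x : Euc N} (hx : R + 1 < ‖x‖) :
    (φ.normed volume ⋆[ContinuousLinearMap.lsmul ℝ ℝ] f : Euc N → ℝ) x = 0 := by
  have := φ.dist_normed_convolution_le (μ := volume) (g := f) (x₀ := x) (ε := 0)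
    hf.aestronglyMeasurable (by
      intro y hy
      rw [Metric.mem_ball] at hy
      have h1 : ‖x‖ ≤ ‖y‖ + dist y x := by
        rw [dist_comm, dist_eq_norm]
        linarith [norm_sub_norm_le x y]
      rw [hR y (by linarith), hR x (by linarith), dist_self])
  rw [hR x (by linarith)] at this
  exact dist_le_zero.1 this

lemma tendsto_integral_abs_rpow_of_bounded {f : Euc N → ℝ} {u : ℕ → Euc N → ℝ}
    (hu : ∀ n, Continuous (u n)) {C R q : ℝ} (hq : 0 < q) (hbound : ∀ n x, |u n x| ≤ C)
    (hzero : ∀ n (x : Euc N), R < ‖x‖ → u n x = 0)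
    (hlim : ∀ x, Tendsto (fun n => u n x) atTop (𝓝 (f x))) :
    Tendsto (fun n => ∫ x, |u n x| ^ q) atTop (𝓝 (∫ x, |f x| ^ q)) := by
  refine tendsto_integral_of_dominated_convergence
    ((Metric.closedBall (0 : Euc N) R).indicator fun _ => C ^ q) ?_ ?_ ?_ ?_
  · exact fun n => ((hu n).abs.rpow_const fun _ => Or.inr hq.le).aestronglyMeasurable
  · exact (integrable_indicator_iff Metric.isClosed_closedBall.measurableSet).2
      (integrableOn_const (isCompact_closedBall _ _).measure_lt_top.ne)
  · refine fun n => Filter.Eventually.of_forall fun x => ?_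
    rw [Real.norm_of_nonneg (Real.rpow_nonneg (abs_nonneg _) _)]
    by_cases hx : x ∈ Metric.closedBall (0 : Euc N) R
    · rw [Set.indicator_of_mem hx]
      exact Real.rpow_le_rpow (abs_nonneg _) (hbound n x) hq.le
    · rw [Set.indicator_of_notMem hx]
      rw [mem_closedBall_zero_iff, not_le] at hx
      rw [hzero n x hx, abs_zero, Real.zero_rpow hq.ne']
  · exact Filter.Eventually.of_forall fun x => (hlim x).abs.rpow_const (Or.inr hq.le)

/-- The Sobolev inequality with constant `S0` for compactly supported functions that are merely
differentiable, with square integrable gradient. -/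
lemma S0_mul_le_of_differentiable (hN : 3 ≤ N) {f : Euc N → ℝ} (hf : Differentiable ℝ f)
    (hc : HasCompactSupport f) (hi : Integrable fun x => ‖gradient f x‖ ^ 2) :
    S0 N * (∫ x, |f x| ^ twoStar N) ^ (2 / twoStar N) ≤ ∫ x, ‖gradient f x‖ ^ 2 := by
  have hq : 0 < twoStar N := by linarith [twoStar_gt hN]
  obtain ⟨φ, hφ1, hφ0⟩ := exists_contDiffBump_seq N
  obtain ⟨C, hC⟩ := hc.exists_bound_of_continuous hf.continuous
  have hC0 : 0 ≤ C := (norm_nonneg _).trans (hC 0)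
  obtain ⟨R, hR⟩ := hc.isBounded.subset_closedBall (0 : Euc N)
  have hzero : ∀ x : Euc N, R < ‖x‖ → f x = 0 := fun x hx => by
    by_contra h
    have := hR (subset_tsupport f h)
    rw [mem_closedBall_zero_iff] at this
    linarith
  have hus : ∀ n, ContDiff ℝ (⊤ : ℕ∞)
      (f ⋆[ContinuousLinearMap.mul ℝ ℝ] (φ n).normed volume) := fun n =>
    (φ n).hasCompactSupport_normed.contDiff_convolution_right _
      hf.continuous.locallyIntegrable (φ n).contDiff_normed
  have hconv := tendsto_integral_abs_rpow_of_bounded (fun n => (hus n).continuous) hq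
    (fun n x => by
      rw [mul_convolution_eq]
      exact abs_normed_convolution_le hf.continuous hC0 hC (φ n) x)
    (fun n x hx => by
      rw [mul_convolution_eq]
      exact normed_convolution_eq_zero hf.continuous hzero (hφ1 n) hx)
    (fun x => by
      simp_rw [mul_convolution_eq]
      exact ContDiffBump.convolution_tendsto_right_of_continuous hφ0 hf.continuous x)
  refine le_of_tendsto ((hconv.rpow_const (Or.inr (by positivity))).const_mul (S0 N)) ?_
  refine Filter.Eventually.of_forall fun n => ?_
  have hcn : HasCompactSupport (f ⋆[ContinuousLinearMap.mul ℝ ℝ] (φ n).normed volume) :=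
    HasCompactSupport.convolution _ hc (φ n).hasCompactSupport_normed
  have h1 := S0_mul_le_of_contDiff hN (hus n) hcn
  have h2 := integral_sq_norm_gradient_convolution_le hf hc hi (φ n)
  exact h1.trans h2

end Sobolev

section Weighted

open Filter Topology

variable {N : ℕ}

lemma hasCompactSupport_sq {f : Euc N → ℝ} (hc : HasCompactSupport f) :
    HasCompactSupport fun x => f x ^ 2 :=
  hc.comp_left (g := fun t : ℝ => t ^ 2) (by simp)

lemma hasCompactSupport_sq_norm_gradient {f : Euc N → ℝ} (hc : HasCompactSupport f) :
    HasCompactSupport fun x => ‖gradient f x‖ ^ 2 :=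
  (hasCompactSupport_gradient hc).comp_left (g := fun v => ‖v‖ ^ 2) (by simp)

lemma gradient_mul {f g : Euc N → ℝ} {x : Euc N} (hf : DifferentiableAt ℝ f x)
    (hg : DifferentiableAt ℝ g x) :
    gradient (fun y => f y * g y) x = f x • gradient g x + g x • gradient f x := by
  rw [gradient, gradient, gradient, fderiv_fun_mul hf hg]
  simp

lemma gradient_sq {f : Euc N → ℝ} {x : Euc N} (hf : DifferentiableAt ℝ f x) :
    gradient (fun y => f y ^ 2) x = (2 * f x) • gradient f x := by
  simp_rw [sq]
  rw [gradient_mul hf hf, ← add_smul, two_mul]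

/-- The divergence theorem for the field `x ↦ f x * h x • x`. -/
lemma integral_mul_radial_divergence {f h : Euc N → ℝ} (hf : Differentiable ℝ f)
    (hc : HasCompactSupport f) (hi : Integrable fun x => ‖gradient f x‖ ^ 2)
    (hh : ContDiff ℝ 1 h) :
    ∫ x, f x * (N * h x + fderiv ℝ h x x) = -∫ x, inner ℝ (gradient f x) (h x • x) := by
  let b := EuclideanSpace.basisFun (Fin N) ℝ
  let g : Fin N → Euc N → ℝ := fun i x => h x * inner ℝ (b i) x
  have hg : ∀ i, ContDiff ℝ 1 (g i) := fun i => hh.mul (contDiff_const.inner ℝ contDiff_id)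
  have hgd : ∀ i x, fderiv ℝ (g i) x (b i) = h x + inner ℝ (b i) x * fderiv ℝ h x (b i) := by
    intro i x
    have h2 : HasFDerivAt (fun x : Euc N => inner ℝ (b i) x) (innerSL ℝ (b i)) x :=
      (innerSL ℝ (b i)).hasFDerivAt
    have h1 := ((hh.differentiable one_ne_zero) x).hasFDerivAt.mul h2
    have h3 : fderiv ℝ (g i) x = _ := h1.fderiv
    rw [h3]
    simp [b.orthonormal.1 i]
  have hfi : Integrable f := hf.continuous.integrable_of_hasCompactSupport hc
  have e1 : ∀ x, f x * (N * h x + fderiv ℝ h x x) = ∑ i, f x * fderiv ℝ (g i) x (b i) := by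
    intro x
    rw [← Finset.mul_sum]
    simp_rw [hgd]
    rw [Finset.sum_add_distrib, Finset.sum_const, Finset.card_univ, Fintype.card_fin, nsmul_eq_mul]
    congr 2
    conv_lhs => rw [← b.sum_repr' x, map_sum]
    simp [b.sum_repr' x]
  have e2 : ∀ x, inner ℝ (gradient f x) (h x • x)
      = ∑ i, inner ℝ (gradient f x) (g i x • b i) := by
    intro x
    rw [← inner_sum]
    congr 1
    conv_lhs => rw [← b.sum_repr' x]
    rw [Finset.smul_sum, b.sum_repr' x]
    simp_rw [smul_smul]
    rfl
  simp_rw [e1, e2]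
  rw [integral_finsetSum, integral_finsetSum, ← Finset.sum_neg_distrib]
  · exact Finset.sum_congr rfl fun i _ => integral_mul_fderiv_eq_neg hf hc hi (hg i) (b i)
  · exact fun i _ => integrable_inner_gradient hc hi ((hg i).continuous.smul continuous_const)
  · exact fun i _ => integrable_mul_of_hasCompactSupport hfi hc
      (((hg i).continuous_fderiv one_ne_zero).clm_apply continuous_const)

lemma integral_sq_mul_radial_divergence {f h : Euc N → ℝ} (hf : Differentiable ℝ f)
    (hc : HasCompactSupport f) (hi : Integrable fun x => ‖gradient f x‖ ^ 2)
    (hh : ContDiff ℝ 1 h) :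
    ∫ x, f x ^ 2 * (N * h x + fderiv ℝ h x x)
      = -∫ x, 2 * f x * h x * inner ℝ (gradient f x) x := by
  have hi2 : Integrable fun x => ‖gradient (fun y => f y ^ 2) x‖ ^ 2 := by
    have := integrable_mul_of_hasCompactSupport hi (hasCompactSupport_sq_norm_gradient hc)
      (g := fun x => (2 * f x) ^ 2) ((continuous_const.mul hf.continuous).pow 2)
    refine this.congr (Filter.Eventually.of_forall fun x => ?_)
    simp only [gradient_sq (hf x), norm_smul, mul_pow, Real.norm_eq_abs, sq_abs]
    ring
  have hdiv : ∫ x, f x ^ 2 * (N * h x + fderiv ℝ h x x)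
      = -∫ x, inner ℝ (gradient (fun y => f y ^ 2) x) (h x • x) :=
    integral_mul_radial_divergence (hf.pow 2) (hasCompactSupport_sq hc) hi2 hh
  rw [hdiv]
  congr 2
  ext x
  rw [gradient_sq (hf x), inner_smul_left, inner_smul_right]
  simp
  ring

lemma integrable_mul_inner_gradient {f k : Euc N → ℝ} (hc : HasCompactSupport f)
    (hi : Integrable fun x => ‖gradient f x‖ ^ 2) (hk : Continuous k) :
    Integrable fun x => k x * inner ℝ (gradient f x) x := by
  have := integrable_inner_gradient hc hi (h := fun x => k x • x) (hk.smul continuous_id)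
  simpa only [inner_smul_right] using this

lemma hardy_regularized (hN : 3 ≤ N) {f : Euc N → ℝ} (hf : Differentiable ℝ f)
    (hc : HasCompactSupport f) (hi : Integrable fun x => ‖gradient f x‖ ^ 2) {ε : ℝ}
    (hε : 0 < ε) :
    ((N : ℝ) - 2) ^ 2 / 4 * ∫ x, f x ^ 2 / (‖x‖ ^ 2 + ε) ≤ ∫ x, ‖gradient f x‖ ^ 2 := by
  have hNr : (3 : ℝ) ≤ N := by exact_mod_cast hN
  set a : ℝ := (N : ℝ) - 2 with ha
  have ha0 : 0 < a := by linarith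
  let s : Euc N → ℝ := fun x => (‖x‖ ^ 2 + ε)⁻¹
  have hpos : ∀ x : Euc N, 0 < ‖x‖ ^ 2 + ε := fun x => by positivity
  have hs : ContDiff ℝ 1 s :=
    ((contDiff_norm_sq ℝ).add contDiff_const).inv fun x => (hpos x).ne'
  have hsd : ∀ x, fderiv ℝ s x x = -(2 * ‖x‖ ^ 2 * s x ^ 2) := by
    intro x
    have h1 : HasFDerivAt (fun x : Euc N => ‖x‖ ^ 2 + ε) (2 • innerSL ℝ x) x :=
      (hasStrictFDerivAt_norm_sq x).hasFDerivAt.add_const ε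
    have h2 : HasFDerivAt s _ x :=
      (hasDerivAt_inv (hpos x).ne').comp_hasFDerivAt x h1
    rw [h2.fderiv]
    simp [s]
    ring
  have hdiv := integral_sq_mul_radial_divergence hf hc hi hs
  have hf2 : Integrable fun x => f x ^ 2 :=
    (hf.continuous.pow 2).integrable_of_hasCompactSupport (hasCompactSupport_sq hc)
  have i1 : Integrable fun x => f x ^ 2 * (N * s x + fderiv ℝ s x x) :=
    integrable_mul_of_hasCompactSupport hf2 (hasCompactSupport_sq hc)
      ((continuous_const.mul hs.continuous).add
        ((hs.continuous_fderiv one_ne_zero).clm_apply continuous_id))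
  have i2 : Integrable fun x => 2 * f x * s x * inner ℝ (gradient f x) x :=
    integrable_mul_inner_gradient hc hi ((continuous_const.mul hf.continuous).mul hs.continuous)
  have i3 : Integrable fun x => f x ^ 2 / (‖x‖ ^ 2 + ε) :=
    integrable_mul_of_hasCompactSupport hf2 (hasCompactSupport_sq hc) hs.continuous
  have i12 : Integrable fun x => a / 2 * (f x ^ 2 * (N * s x + fderiv ℝ s x x))
      + a / 2 * (2 * f x * s x * inner ℝ (gradient f x) x) :=
    (i1.const_mul _).add (i2.const_mul _)
  have key : ∫ x, a ^ 2 / 4 * (f x ^ 2 / (‖x‖ ^ 2 + ε)) ≤ ∫ x, (‖gradient f x‖ ^ 2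
      + (a / 2 * (f x ^ 2 * (N * s x + fderiv ℝ s x x))
        + a / 2 * (2 * f x * s x * inner ℝ (gradient f x) x))) := by
    refine integral_mono (i3.const_mul _) (hi.add i12) ?_
    intro x
    dsimp only
    have h1 : 0 ≤ ‖gradient f x + (a / 2 * f x * s x) • x‖ ^ 2 := by positivity
    rw [norm_add_sq_real, inner_smul_right, norm_smul, mul_pow, Real.norm_eq_abs, sq_abs] at h1
    have hs0 : 0 < s x := inv_pos.2 (hpos x)
    have h2 : ‖x‖ ^ 2 * s x ≤ 1 := by
      change ‖x‖ ^ 2 * (‖x‖ ^ 2 + ε)⁻¹ ≤ 1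
      rw [← div_eq_mul_inv, div_le_one (hpos x)]
      linarith
    have h3 : f x ^ 2 / (‖x‖ ^ 2 + ε) = f x ^ 2 * s x := div_eq_mul_inv _ _
    have h4 : (N : ℝ) = a + 2 := by rw [ha]; ring
    rw [h3, hsd, h4]
    have h5 : 0 ≤ (a + a ^ 2 / 4) * (f x ^ 2 * s x * (1 - ‖x‖ ^ 2 * s x)) := by
      have : 0 ≤ 1 - ‖x‖ ^ 2 * s x := by linarith
      positivity
    nlinarith
  rw [integral_const_mul, integral_add hi i12,
    integral_add (i1.const_mul _) (i2.const_mul _), integral_const_mul, integral_const_mul,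
    hdiv] at key
  linarith

lemma ae_ne_zero (hN : 3 ≤ N) : ∀ᵐ x : Euc N, x ≠ 0 := by
  have : Nonempty (Fin N) := ⟨⟨0, by omega⟩⟩
  have : Nontrivial (Euc N) := inferInstance
  exact Measure.ae_ne volume 0

/-- Hardy's inequality. -/
lemma hardy (hN : 3 ≤ N) {f : Euc N → ℝ} (hf : Differentiable ℝ f)
    (hc : HasCompactSupport f) (hi : Integrable fun x => ‖gradient f x‖ ^ 2)
    (hh : Integrable fun x => f x ^ 2 / ‖x‖ ^ 2) :
    ((N : ℝ) - 2) ^ 2 / 4 * ∫ x, f x ^ 2 / ‖x‖ ^ 2 ≤ ∫ x, ‖gradient f x‖ ^ 2 := by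
  have hconv : Tendsto (fun n : ℕ => ∫ x, f x ^ 2 / (‖x‖ ^ 2 + 1 / ((n : ℝ) + 1))) atTop
      (𝓝 (∫ x, f x ^ 2 / ‖x‖ ^ 2)) := by
    refine tendsto_integral_of_dominated_convergence _ (fun n => ?_) hh (fun n => ?_) ?_
    · refine Continuous.aestronglyMeasurable ?_
      exact (hf.continuous.pow 2).div ((continuous_norm.pow 2).add continuous_const)
        fun x => by positivity
    · filter_upwards [ae_ne_zero hN] with x hx
      have hx' : 0 < ‖x‖ := norm_pos_iff.2 hx
      rw [Real.norm_of_nonneg (by positivity)]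
      gcongr
      have : 0 < 1 / ((n : ℝ) + 1) := by positivity
      linarith
    · filter_upwards [ae_ne_zero hN] with x hx
      have hx' : 0 < ‖x‖ := norm_pos_iff.2 hx
      refine tendsto_const_nhds.div ?_ (by positivity)
      simpa using (tendsto_one_div_add_atTop_nhds_zero_nat (𝕜 := ℝ)).const_add (‖x‖ ^ 2)
  refine le_of_tendsto (hconv.const_mul _) (Filter.Eventually.of_forall fun n => ?_)
  exact hardy_regularized hN hf hc hi (by positivity)

/-- The square root of the weight `Kw`. -/
def sqrtKw (x : Euc N) : ℝ := Real.exp (‖x‖ ^ 2 / 8)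

lemma sqrtKw_sq (x : Euc N) : sqrtKw x ^ 2 = Kw x := by
  rw [sqrtKw, Kw, ← Real.exp_nat_mul]
  congr 1
  push_cast
  ring

lemma one_le_sqrtKw (x : Euc N) : 1 ≤ sqrtKw x := Real.one_le_exp (by positivity)

lemma Kw_pos (x : Euc N) : 0 < Kw x := Real.exp_pos _

lemma one_le_Kw (x : Euc N) : 1 ≤ Kw x := Real.one_le_exp (by positivity)

lemma contDiff_sqrtKw : ContDiff ℝ 1 (sqrtKw (N := N)) :=
  ((contDiff_norm_sq ℝ).div_const 8).exp

lemma contDiff_Kw : ContDiff ℝ 1 (Kw (N := N)) :=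
  ((contDiff_norm_sq ℝ).div_const 4).exp

lemma hasFDerivAt_exp_norm_sq (c : ℝ) (x : Euc N) :
    HasFDerivAt (fun y : Euc N => Real.exp (‖y‖ ^ 2 / c))
      ((2 / c * Real.exp (‖x‖ ^ 2 / c)) • innerSL ℝ x) x := by
  have h1 : HasFDerivAt (fun y : Euc N => ‖y‖ ^ 2 * c⁻¹) (c⁻¹ • (2 • innerSL ℝ x)) x :=
    (hasStrictFDerivAt_norm_sq x).hasFDerivAt.mul_const c⁻¹
  have h2 := h1.exp
  simp_rw [← div_eq_mul_inv] at h2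
  refine h2.congr_fderiv ?_
  ext y
  simp
  ring

lemma fderiv_Kw_self (x : Euc N) : fderiv ℝ Kw x x = ‖x‖ ^ 2 / 2 * Kw x := by
  have h : HasFDerivAt (Kw (N := N)) _ x := hasFDerivAt_exp_norm_sq 4 x
  rw [h.fderiv]
  simp [Kw]
  ring

lemma gradient_sqrtKw (x : Euc N) : gradient sqrtKw x = (1 / 4 * sqrtKw x) • x := by
  have h : HasFDerivAt (sqrtKw (N := N)) _ x := hasFDerivAt_exp_norm_sq 8 x
  refine HasGradientAt.gradient ?_
  rw [hasGradientAt_iff_hasFDerivAt]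
  refine h.congr_fderiv ?_
  ext y
  simp [sqrtKw]
  norm_num

lemma sq_norm_gradient_sqrtKw_mul {v : Euc N → ℝ} {x : Euc N} (hv : DifferentiableAt ℝ v x) :
    ‖gradient (fun y => sqrtKw y * v y) x‖ ^ 2 = ‖gradient v x‖ ^ 2 * Kw x
      + 1 / 4 * (2 * v x * Kw x * inner ℝ (gradient v x) x)
      + 1 / 16 * (v x ^ 2 * (‖x‖ ^ 2 * Kw x)) := by
  rw [gradient_mul ((contDiff_sqrtKw.differentiable one_ne_zero) x) hv, gradient_sqrtKw,
    norm_add_sq_real, norm_smul, smul_smul, norm_smul, inner_smul_left, inner_smul_right,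
    mul_pow, mul_pow, Real.norm_eq_abs, Real.norm_eq_abs, sq_abs, sq_abs, ← sqrtKw_sq]
  simp
  ring

lemma integral_weighted_gradient {v : Euc N → ℝ} (hv : Differentiable ℝ v)
    (hc : HasCompactSupport v) (hi : Integrable fun x => ‖gradient v x‖ ^ 2) :
    (Integrable fun x => ‖gradient (fun y => sqrtKw y * v y) x‖ ^ 2) ∧
    (∫ x, ‖gradient (fun y => sqrtKw y * v y) x‖ ^ 2) + (N : ℝ) / 4 * ∫ x, v x ^ 2 * Kw x
      ≤ ∫ x, ‖gradient v x‖ ^ 2 * Kw x := by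
  have hK : Continuous (Kw (N := N)) := contDiff_Kw.continuous
  have hv2 : Integrable fun x => v x ^ 2 :=
    (hv.continuous.pow 2).integrable_of_hasCompactSupport (hasCompactSupport_sq hc)
  have i1 : Integrable fun x => ‖gradient v x‖ ^ 2 * Kw x :=
    integrable_mul_of_hasCompactSupport hi (hasCompactSupport_sq_norm_gradient hc) hK
  have i2 : Integrable fun x => 2 * v x * Kw x * inner ℝ (gradient v x) x :=
    integrable_mul_inner_gradient hc hi ((continuous_const.mul hv.continuous).mul hK)
  have i3 : Integrable fun x => v x ^ 2 * (‖x‖ ^ 2 * Kw x) :=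
    integrable_mul_of_hasCompactSupport hv2 (hasCompactSupport_sq hc)
      ((continuous_norm.pow 2).mul hK)
  have i4 : Integrable fun x => v x ^ 2 * Kw x :=
    integrable_mul_of_hasCompactSupport hv2 (hasCompactSupport_sq hc) hK
  have i12 : Integrable fun x => ‖gradient v x‖ ^ 2 * Kw x
      + 1 / 4 * (2 * v x * Kw x * inner ℝ (gradient v x) x) := i1.add (i2.const_mul _)
  have hsum := i12.add (i3.const_mul (1 / 16))
  have heq : (fun x => ‖gradient (fun y => sqrtKw y * v y) x‖ ^ 2) = _ :=
    funext fun x => sq_norm_gradient_sqrtKw_mul (hv x)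
  refine ⟨heq ▸ hsum, ?_⟩
  have hdiv := integral_sq_mul_radial_divergence hv hc hi contDiff_Kw
  have e1 : ∀ x, v x ^ 2 * (N * Kw x + fderiv ℝ Kw x x)
      = N * (v x ^ 2 * Kw x) + 1 / 2 * (v x ^ 2 * (‖x‖ ^ 2 * Kw x)) := by
    intro x
    rw [fderiv_Kw_self]
    ring
  simp_rw [e1] at hdiv
  rw [integral_add (i4.const_mul _) (i3.const_mul _), integral_const_mul,
    integral_const_mul] at hdiv
  rw [heq, integral_add i12 (i3.const_mul _),
    integral_add i1 (i2.const_mul _), integral_const_mul, integral_const_mul]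
  have h3 : 0 ≤ ∫ x, v x ^ 2 * (‖x‖ ^ 2 * Kw x) :=
    integral_nonneg fun x => mul_nonneg (sq_nonneg _) (mul_nonneg (sq_nonneg _) (Kw_pos x).le)
  linarith

lemma Bfun_le {v : Euc N → ℝ} (hN : 3 ≤ N) (hv : Continuous v) (hc : HasCompactSupport v) :
    Bfun v ≤ ∫ x, |sqrtKw x * v x| ^ twoStar N := by
  have hq := twoStar_gt hN
  have hq0 : 0 < twoStar N := by linarith
  refine integral_mono_of_nonneg (Filter.Eventually.of_forall fun x =>
    mul_nonneg (Real.rpow_nonneg (abs_nonneg _) _) (Kw_pos x).le)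
    (integrable_abs_rpow (contDiff_sqrtKw.continuous.mul hv) hc.mul_left hq0)
    (Filter.Eventually.of_forall fun x => ?_)
  dsimp only
  have h1 := one_le_sqrtKw x
  rw [abs_mul, Real.mul_rpow (abs_nonneg _) (abs_nonneg _), abs_of_pos (zero_lt_one.trans_le h1),
    mul_comm, ← sqrtKw_sq, ← Real.rpow_natCast]
  refine mul_le_mul_of_nonneg_right ?_ (Real.rpow_nonneg (abs_nonneg _) _)
  exact Real.rpow_le_rpow_of_exponent_le h1 (by push_cast; exact hq.le)

lemma Bfun_nonneg (v : Euc N → ℝ) : 0 ≤ Bfun v :=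
  integral_nonneg fun x => mul_nonneg (Real.rpow_nonneg (abs_nonneg _) _) (Kw_pos x).le

lemma S0_half_mul_le_of_hasCompactSupport (hN : 3 ≤ N) {μ : ℝ}
    (hμ : μ ≤ ((N : ℝ) - 2) ^ 2 / 8) {v : Euc N → ℝ} (hv : Differentiable ℝ v)
    (hc : HasCompactSupport v) (hi : Integrable fun x => ‖gradient v x‖ ^ 2 * Kw x)
    (hh : Integrable fun x => v x ^ 2 / ‖x‖ ^ 2 * Kw x) :
    S0 N / 2 * normKp1Sq v ≤ Afun μ v := by
  have hq := twoStar_gt hN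
  have hK : Continuous (Kw (N := N)) := contDiff_Kw.continuous
  have hi0 : Integrable fun x => ‖gradient v x‖ ^ 2 := by
    refine hi.mono' ((measurable_gradient v).norm.pow_const 2).aestronglyMeasurable
      (Filter.Eventually.of_forall fun x => ?_)
    rw [Real.norm_of_nonneg (by positivity)]
    exact le_mul_of_one_le_right (by positivity) (one_le_Kw x)
  have i4 : Integrable fun x => v x ^ 2 * Kw x :=
    ((hv.continuous.pow 2).mul hK).integrable_of_hasCompactSupport
      (hasCompactSupport_sq hc).mul_right
  obtain ⟨hwi, hw⟩ := integral_weighted_gradient hv hc hi0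
  have hwd : Differentiable ℝ fun x => sqrtKw x * v x :=
    (contDiff_sqrtKw.differentiable one_ne_zero).mul hv
  have hwc : HasCompactSupport fun x => sqrtKw x * v x := hc.mul_left
  have hweq : ∀ x, (sqrtKw x * v x) ^ 2 / ‖x‖ ^ 2 = v x ^ 2 / ‖x‖ ^ 2 * Kw x := by
    intro x
    rw [mul_pow, sqrtKw_sq]
    ring
  have hhardy := hardy hN hwd hwc hwi (by simpa only [hweq] using hh)
  simp_rw [hweq] at hhardy
  have hsob := S0_mul_le_of_differentiable hN hwd hwc hwi
  have hB : normKp1Sq v ≤ (∫ x, |sqrtKw x * v x| ^ twoStar N) ^ (2 / twoStar N) :=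
    Real.rpow_le_rpow (Bfun_nonneg v) (Bfun_le hN hv.continuous hc) (by positivity)
  have hA : Afun μ v = (∫ x, ‖gradient v x‖ ^ 2 * Kw x)
      - μ * (∫ x, v x ^ 2 / ‖x‖ ^ 2 * Kw x) - ((N : ℝ) - 2) / 4 * ∫ x, v x ^ 2 * Kw x := by
    have i12 : Integrable fun x => ‖gradient v x‖ ^ 2 * Kw x - μ * (v x ^ 2 / ‖x‖ ^ 2 * Kw x) :=
      hi.sub (hh.const_mul μ)
    rw [← integral_const_mul, ← integral_const_mul, ← integral_sub hi (hh.const_mul μ),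
      ← integral_sub i12 (i4.const_mul _)]
    refine integral_congr_ae (Filter.Eventually.of_forall fun x => ?_)
    dsimp only
    ring
  have hH0 : 0 ≤ ∫ x, v x ^ 2 / ‖x‖ ^ 2 * Kw x :=
    integral_nonneg fun x => mul_nonneg (by positivity) (Kw_pos x).le
  have hV0 : 0 ≤ ∫ x, v x ^ 2 * Kw x :=
    integral_nonneg fun x => mul_nonneg (by positivity) (Kw_pos x).le
  have hμH := mul_le_mul_of_nonneg_right hμ hH0
  have hS := mul_le_mul_of_nonneg_left hB (S0_pos hN).le
  rw [hA]
  linarith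

end Weighted

section Truncation

open Filter Topology

variable {N : ℕ}

lemma exists_cutoff_seq (N : ℕ) : ∃ (χ : ℕ → Euc N → ℝ) (C : ℝ),
    (∀ n, Differentiable ℝ (χ n)) ∧ (∀ n, HasCompactSupport (χ n)) ∧
    (∀ n x, |χ n x| ≤ 1) ∧ (∀ n x, ‖gradient (χ n) x‖ ≤ C) ∧
    ∀ x, ∀ᶠ n in atTop, χ n =ᶠ[𝓝 x] fun _ => 1 := by
  let φ : ContDiffBump (0 : Euc N) := ⟨1, 2, one_pos, one_lt_two⟩
  have hφ : ContDiff ℝ 1 φ := φ.contDiff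
  obtain ⟨C, hC⟩ := (hφ.continuous_fderiv one_ne_zero).bounded_above_of_compact_support
    (φ.hasCompactSupport.fderiv (𝕜 := ℝ))
  have hpos : ∀ n : ℕ, (0 : ℝ) < n + 1 := fun n => by positivity
  refine ⟨fun n x => φ (((n : ℝ) + 1)⁻¹ • x), C, fun n => ?_, fun n => ?_, fun n x => ?_,
    fun n x => ?_, fun x => ?_⟩
  · exact (hφ.differentiable one_ne_zero).comp (differentiable_id.fun_const_smul _)
  · exact φ.hasCompactSupport.comp_smul (inv_ne_zero (hpos n).ne')
  · rw [abs_of_nonneg φ.nonneg]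
    exact φ.le_one
  · have h1 : HasFDerivAt (fun x : Euc N => ((n : ℝ) + 1)⁻¹ • x)
        (((n : ℝ) + 1)⁻¹ • ContinuousLinearMap.id ℝ (Euc N)) x :=
      (hasFDerivAt_id x).fun_const_smul _
    have h2 : HasFDerivAt (fun x : Euc N => φ (((n : ℝ) + 1)⁻¹ • x)) _ x :=
      ((hφ.differentiable one_ne_zero) _).hasFDerivAt.comp x h1
    rw [norm_gradient_eq, h2.fderiv, ContinuousLinearMap.comp_smul,
      ContinuousLinearMap.comp_id, norm_smul]
    have h3 : ‖((n : ℝ) + 1)⁻¹‖ ≤ 1 := by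
      rw [norm_inv, Real.norm_of_nonneg (hpos n).le]
      exact inv_le_one_of_one_le₀ (by linarith [(Nat.cast_nonneg n : (0 : ℝ) ≤ n)])
    exact (mul_le_of_le_one_left (norm_nonneg _) h3).trans (hC _)
  · obtain ⟨m, hm⟩ := exists_nat_gt ‖x‖
    filter_upwards [eventually_ge_atTop m] with n hn
    have hn' : (m : ℝ) ≤ n := by exact_mod_cast hn
    have hlt : ‖x‖ < n + 1 := by linarith
    filter_upwards [(isOpen_lt continuous_norm continuous_const).mem_nhds hlt] with y hy
    refine φ.one_of_mem_closedBall ?_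
    rw [mem_closedBall_zero_iff, norm_smul, norm_inv, Real.norm_of_nonneg (hpos n).le,
      inv_mul_le_iff₀ (hpos n)]
    change ‖y‖ < n + 1 at hy
    change ‖y‖ ≤ (n + 1) * 1
    linarith

lemma sq_norm_gradient_mul_le {χ v : Euc N → ℝ} {C : ℝ} {x : Euc N}
    (hχ : DifferentiableAt ℝ χ x) (hv : DifferentiableAt ℝ v x) (h1 : |χ x| ≤ 1)
    (hC : ‖gradient χ x‖ ≤ C) :
    ‖gradient (fun y => χ y * v y) x‖ ^ 2 ≤ 2 * ‖gradient v x‖ ^ 2 + 2 * C ^ 2 * v x ^ 2 := by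
  rw [gradient_mul hχ hv]
  have h2 : ‖χ x • gradient v x + v x • gradient χ x‖ ≤ ‖gradient v x‖ + |v x| * C := by
    refine (norm_add_le _ _).trans (add_le_add ?_ ?_)
    · rw [norm_smul]
      exact mul_le_of_le_one_left (norm_nonneg _) h1
    · rw [norm_smul]
      exact mul_le_mul_of_nonneg_left hC (abs_nonneg _)
  have h3 := pow_le_pow_left₀ (norm_nonneg _) h2 2
  have h4 := sq_abs (v x)
  rw [← h4]
  nlinarith [sq_nonneg (‖gradient v x‖ - |v x| * C)]

lemma abs_sub_sub_le_add {a b c : ℝ} (ha : 0 ≤ a) (hb : 0 ≤ b) (hc : 0 ≤ c) :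
    |a - b - c| ≤ a + b + c := by
  rw [abs_le]
  constructor <;> linarith

lemma S0_half_mul_le_of_memX (hN : 3 ≤ N) {μ : ℝ}
    (hμ : μ ∈ Set.Icc (0 : ℝ) (((N : ℝ) - 2) ^ 2 / 8)) {v : Euc N → ℝ} (hv : MemX v) :
    S0 N / 2 * normKp1Sq v ≤ Afun μ v := by
  have hNr : (3 : ℝ) ≤ N := by exact_mod_cast hN
  have hq := twoStar_gt hN
  have hK : Continuous (Kw (N := N)) := contDiff_Kw.continuous
  obtain ⟨χ, C, hχd, hχc, hχ1, hχC, hχe⟩ := exists_cutoff_seq N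
  let w : ℕ → Euc N → ℝ := fun n x => χ n x * v x
  have hwd : ∀ n, Differentiable ℝ (w n) := fun n => (hχd n).mul hv.diff
  have hwg : ∀ n x, ‖gradient (w n) x‖ ^ 2 ≤ 2 * ‖gradient v x‖ ^ 2 + 2 * C ^ 2 * v x ^ 2 :=
    fun n x => sq_norm_gradient_mul_le (hχd n x) (hv.diff x) (hχ1 n x) (hχC n x)
  have hwabs : ∀ n x, |w n x| ≤ |v x| := fun n x => by
    change |χ n x * v x| ≤ |v x|
    rw [abs_mul]
    exact mul_le_of_le_one_left (abs_nonneg _) (hχ1 n x)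
  have hw2 : ∀ n x, w n x ^ 2 ≤ v x ^ 2 := fun n x => sq_le_sq.2 (hwabs n x)
  have hwe : ∀ x, ∀ᶠ n in atTop, w n x = v x ∧ gradient (w n) x = gradient v x := by
    intro x
    filter_upwards [hχe x] with n hn
    have h : w n =ᶠ[𝓝 x] v := by
      filter_upwards [hn] with y hy
      change χ n y * v y = v y
      rw [hy, one_mul]
    exact ⟨h.eq_of_nhds, h.gradient_eq⟩
  have hgm : ∀ n, AEStronglyMeasurable (fun x => ‖gradient (w n) x‖ ^ 2) volume := fun n =>
    ((measurable_gradient _).norm.pow_const 2).aestronglyMeasurable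
  have hhm : ∀ n, AEStronglyMeasurable (fun x => w n x ^ 2 / ‖x‖ ^ 2) volume := fun n =>
    (((hwd n).continuous.pow 2).measurable.div
      (continuous_norm.pow 2).measurable).aestronglyMeasurable
  have hdom : Integrable fun x => (2 * ‖gradient v x‖ ^ 2 + 2 * C ^ 2 * v x ^ 2) * Kw x := by
    refine ((hv.int_grad.const_mul 2).add (hv.int_sq.const_mul (2 * C ^ 2))).congr
      (Eventually.of_forall fun x => ?_)
    simp only [Pi.add_apply]
    ring
  have hwi : ∀ n, Integrable fun x => ‖gradient (w n) x‖ ^ 2 * Kw x := by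
    refine fun n => hdom.mono' ((hgm n).mul hK.aestronglyMeasurable)
      (Eventually.of_forall fun x => ?_)
    rw [Real.norm_of_nonneg (mul_nonneg (sq_nonneg _) (Kw_pos x).le)]
    exact mul_le_mul_of_nonneg_right (hwg n x) (Kw_pos x).le
  have hwh : ∀ n, Integrable fun x => w n x ^ 2 / ‖x‖ ^ 2 * Kw x := by
    refine fun n => hv.int_hardy.mono' ((hhm n).mul hK.aestronglyMeasurable)
      (Eventually.of_forall fun x => ?_)
    rw [Real.norm_of_nonneg (mul_nonneg (by positivity) (Kw_pos x).le)]
    exact mul_le_mul_of_nonneg_right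
      (div_le_div_of_nonneg_right (hw2 n x) (sq_nonneg _)) (Kw_pos x).le
  have hA : Tendsto (fun n => Afun μ (w n)) atTop (𝓝 (Afun μ v)) := by
    refine tendsto_integral_of_dominated_convergence
      (fun x => (2 * ‖gradient v x‖ ^ 2 + 2 * C ^ 2 * v x ^ 2) * Kw x
        + μ * (v x ^ 2 / ‖x‖ ^ 2 * Kw x) + ((N : ℝ) - 2) / 4 * (v x ^ 2 * Kw x))
      (fun n => ?_) ((hdom.add (hv.int_hardy.const_mul μ)).add (hv.int_sq.const_mul _))
      (fun n => Eventually.of_forall fun x => ?_) (Eventually.of_forall fun x => ?_)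
    · simp_rw [mul_div_assoc]
      exact (((hgm n).sub ((hhm n).const_mul μ)).sub
        (((hwd n).continuous.pow 2).aestronglyMeasurable.const_mul _)).mul hK.aestronglyMeasurable
    · rw [Real.norm_eq_abs, abs_mul, abs_of_pos (Kw_pos x)]
      have h1 : μ * w n x ^ 2 / ‖x‖ ^ 2 ≤ μ * v x ^ 2 / ‖x‖ ^ 2 :=
        div_le_div_of_nonneg_right (mul_le_mul_of_nonneg_left (hw2 n x) hμ.1) (sq_nonneg _)
      have h2 : ((N : ℝ) - 2) / 4 * w n x ^ 2 ≤ ((N : ℝ) - 2) / 4 * v x ^ 2 :=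
        mul_le_mul_of_nonneg_left (hw2 n x) (by linarith)
      have h3 := abs_sub_sub_le_add (sq_nonneg ‖gradient (w n) x‖)
        (div_nonneg (mul_nonneg hμ.1 (sq_nonneg (w n x))) (sq_nonneg ‖x‖))
        (mul_nonneg (by linarith : (0 : ℝ) ≤ ((N : ℝ) - 2) / 4) (sq_nonneg (w n x)))
      have h4 := mul_le_mul_of_nonneg_right
        (h3.trans (add_le_add (add_le_add (hwg n x) h1) h2)) (Kw_pos x).le
      refine h4.trans_eq ?_
      ring
    · refine tendsto_const_nhds.congr' ?_
      filter_upwards [hwe x] with n hn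
      rw [hn.1, hn.2]
  have hB : Tendsto (fun n => Bfun (w n)) atTop (𝓝 (Bfun v)) := by
    refine tendsto_integral_of_dominated_convergence _ (fun n => ?_) hv.int_crit
      (fun n => Eventually.of_forall fun x => ?_) (Eventually.of_forall fun x => ?_)
    · exact (((hwd n).continuous.abs.rpow_const fun _ => Or.inr (by linarith)).mul
        hK).aestronglyMeasurable
    · rw [Real.norm_of_nonneg
        (mul_nonneg (Real.rpow_nonneg (abs_nonneg _) _) (Kw_pos x).le)]
      exact mul_le_mul_of_nonneg_right
        (Real.rpow_le_rpow (abs_nonneg _) (hwabs n x) (by linarith)) (Kw_pos x).le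
    · refine tendsto_const_nhds.congr' ?_
      filter_upwards [hwe x] with n hn
      rw [hn.1]
  have hn : Tendsto (fun n => S0 N / 2 * normKp1Sq (w n)) atTop
      (𝓝 (S0 N / 2 * normKp1Sq v)) :=
    (hB.rpow_const (Or.inr (by positivity))).const_mul _
  exact le_of_tendsto_of_tendsto' hn hA fun n =>
    S0_half_mul_le_of_hasCompactSupport hN hμ.2 (hwd n) (hχc n).mul_right (hwi n) (hwh n)

lemma Bfun_pos (hN : 3 ≤ N) {v : Euc N → ℝ} (hv : MemX v) (h0 : v ≠ 0) : 0 < Bfun v :=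
  integral_abs_rpow_pos hv.diff.continuous h0 (zero_lt_two.trans (twoStar_gt hN))
    contDiff_Kw.continuous Kw_pos hv.int_crit

lemma exists_memX_ne_zero (hN : 3 ≤ N) : ∃ v : Euc N → ℝ, MemX v ∧ v ≠ 0 := by
  let e : Euc N := EuclideanSpace.single ⟨0, by omega⟩ 1
  have he : ‖e‖ = 1 := by simp [e]
  let φ : ContDiffBump e := ⟨1 / 4, 1 / 2, by norm_num, by norm_num⟩
  have hφ : ContDiff ℝ 1 φ := φ.contDiff
  have hc := φ.hasCompactSupport
  have hK : Continuous (Kw (N := N)) := contDiff_Kw.continuous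
  have hq := twoStar_gt hN
  have hsq : Integrable fun x => φ x ^ 2 * Kw x :=
    ((hφ.continuous.pow 2).mul hK).integrable_of_hasCompactSupport
      (hasCompactSupport_sq hc).mul_right
  refine ⟨φ, ⟨hφ.differentiable one_ne_zero, ?_, hsq, ?_, ?_⟩, fun h => ?_⟩
  · exact (((continuous_gradient hφ).norm.pow 2).mul hK).integrable_of_hasCompactSupport
      (hasCompactSupport_sq_norm_gradient hc).mul_right
  · refine (hsq.const_mul 4).mono' (((hφ.continuous.pow 2).measurable.div
      (continuous_norm.pow 2).measurable).mul hK.measurable).aestronglyMeasurable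
      (Eventually.of_forall fun x => ?_)
    rw [Real.norm_of_nonneg (mul_nonneg (by positivity) (Kw_pos x).le), ← mul_assoc]
    refine mul_le_mul_of_nonneg_right ?_ (Kw_pos x).le
    rcases le_or_gt (1 / 2) (dist x e) with h | h
    · rw [φ.zero_of_le_dist h]
      simp
    · have h1 : 1 / 2 ≤ ‖x‖ := by
        have h2 := norm_sub_norm_le e x
        rw [dist_eq_norm, norm_sub_rev] at h
        linarith
      rw [div_le_iff₀ (by positivity)]
      nlinarith [mul_le_mul_of_nonneg_left (pow_le_pow_left₀ (by norm_num) h1 2)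
        (sq_nonneg (φ x))]
  · exact ((hφ.continuous.abs.rpow_const fun _ => Or.inr (by linarith)).mul
      hK).integrable_of_hasCompactSupport
      (hc.comp_left (g := fun t : ℝ => |t| ^ twoStar N)
        (by simp [(zero_lt_two.trans hq).ne'])).mul_right
  · have h1 : φ e = 1 := φ.one_of_mem_closedBall (Metric.mem_closedBall_self φ.rIn_pos.le)
    rw [h] at h1
    simp at h1

end Truncation

/-- A(v) ≥ (S₀/2)‖v‖²_{K,p+1}, hence S_K ≥ S₀/2 > 0. -/
theorem SK_ge_half_S0 (N : ℕ) (hN : 3 ≤ N) (μ : ℝ)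
    (hμ : μ ∈ Set.Icc (0 : ℝ) (((N : ℝ) - 2) ^ 2 / 8)) :
    (∀ v : Euc N → ℝ, MemX v → v ≠ 0 → S0 N / 2 * normKp1Sq v ≤ Afun μ v) ∧
    S0 N / 2 ≤ SK N μ ∧ 0 < S0 N / 2 := by
  have hmain : ∀ v : Euc N → ℝ, MemX v → v ≠ 0 → S0 N / 2 * normKp1Sq v ≤ Afun μ v :=
    fun _ hv _ => S0_half_mul_le_of_memX hN hμ hv
  refine ⟨hmain, le_csInf ?_ ?_, half_pos (S0_pos hN)⟩
  · obtain ⟨v, hv, h0⟩ := exists_memX_ne_zero hN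
    exact ⟨_, v, hv, h0, rfl⟩
  · rintro _ ⟨v, hv, h0, rfl⟩
    have hpos : 0 < normKp1Sq v := Real.rpow_pos_of_pos (Bfun_pos hN hv h0) _
    exact (le_div_iff₀ hpos).2 (hmain v hv h0)
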